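/- Under the assumptions ‖U_t‖ ≤ 3‖U♮‖, σ_min(U_tW_t) ≥ σ_min(U♮)/√10, and ‖V_{X♮⊥}ᵀV_{U_tW_t}‖ ≤ c·κ_f^{-2} for a sufficiently small constant c > 0, the spectral-norm bound ‖X♮ − U_tW_tW_tᵀU_tᵀ‖ ≤ 4·‖V_{X♮}ᵀ(X♮ − U_tU_tᵀ)‖ holds. -/

import Mathlib

open scoped BigOperators
open Matrix MeasureTheory ProbabilityTheory

noncomputable section

/-- Euclidean (ℓ²) norm of a vector in `ℝ^n`. -/
def vecNorm {n : ℕ} (v : Fin n → ℝ) : ℝ := Real.sqrt (∑ i, (v i) ^ 2)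

/-- Frobenius norm of a matrix. -/
def frobNorm {m n : ℕ} (A : Matrix (Fin m) (Fin n) ℝ) : ℝ :=
  Real.sqrt (∑ i, ∑ j, (A i j) ^ 2)

/-- The `k`-th largest singular value of a matrix, via the Courant–Fischer
min-max characterization. -/
def singVal {m n : ℕ} (A : Matrix (Fin m) (Fin n) ℝ) (k : ℕ) : ℝ :=
  sSup {c : ℝ | 0 ≤ c ∧ ∃ V : Submodule ℝ (Fin n → ℝ),
    Module.finrank ℝ V = k ∧ ∀ x ∈ V, c * vecNorm x ≤ vecNorm (A.mulVec x)}

/-- Spectral (operator) norm: the largest singular value. -/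
def specNorm {m n : ℕ} (A : Matrix (Fin m) (Fin n) ℝ) : ℝ := singVal A 1

/-- Nuclear norm: the sum of all singular values. -/
def nucNorm {m n : ℕ} (A : Matrix (Fin m) (Fin n) ℝ) : ℝ :=
  ∑ k ∈ Finset.Icc 1 (min m n), singVal A k

section L2Operator

open scoped Matrix.Norms.L2Operator

lemma vecNorm_eq_norm_toLp {n : ℕ} (v : Fin n → ℝ) : vecNorm v = ‖WithLp.toLp 2 v‖ := by
  simp [vecNorm, EuclideanSpace.norm_eq]

lemma vecNorm_pos {n : ℕ} {v : Fin n → ℝ} (hv : v ≠ 0) : 0 < vecNorm v := by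
  rw [vecNorm_eq_norm_toLp, norm_pos_iff]
  simpa using hv

lemma vecNorm_smul {n : ℕ} (a : ℝ) (v : Fin n → ℝ) : vecNorm (a • v) = |a| * vecNorm v := by
  rw [vecNorm_eq_norm_toLp, vecNorm_eq_norm_toLp, WithLp.toLp_smul, norm_smul, Real.norm_eq_abs]

lemma vecNorm_mulVec_le {m n : ℕ} (A : Matrix (Fin m) (Fin n) ℝ) (x : Fin n → ℝ) :
    vecNorm (A.mulVec x) ≤ ‖A‖ * vecNorm x := by
  rw [vecNorm_eq_norm_toLp, vecNorm_eq_norm_toLp]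
  exact Matrix.l2_opNorm_mulVec A (WithLp.toLp 2 x)

lemma norm_mem_upperBounds_singVal {m n : ℕ} (A : Matrix (Fin m) (Fin n) ℝ) {k : ℕ}
    (hk : 0 < k) :
    ‖A‖ ∈ upperBounds {c : ℝ | 0 ≤ c ∧ ∃ V : Submodule ℝ (Fin n → ℝ),
      Module.finrank ℝ V = k ∧ ∀ x ∈ V, c * vecNorm x ≤ vecNorm (A.mulVec x)} := by
  rintro c ⟨-, V, hV, hc⟩
  have hne : V ≠ ⊥ := by
    rintro rfl
    simp at hV
    omega
  obtain ⟨x, hx, hx0⟩ := V.exists_mem_ne_zero_of_ne_bot hne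
  exact le_of_mul_le_mul_right ((hc x hx).trans (vecNorm_mulVec_le A x)) (vecNorm_pos hx0)

lemma singVal_nonneg {m n : ℕ} (A : Matrix (Fin m) (Fin n) ℝ) (k : ℕ) : 0 ≤ singVal A k :=
  Real.sSup_nonneg fun _ hc => hc.1

lemma singVal_le_norm {m n : ℕ} (A : Matrix (Fin m) (Fin n) ℝ) {k : ℕ} (hk : 0 < k) :
    singVal A k ≤ ‖A‖ :=
  Real.sSup_le (norm_mem_upperBounds_singVal A hk) (norm_nonneg A)

lemma specNorm_eq_norm {m n : ℕ} (A : Matrix (Fin m) (Fin n) ℝ) : specNorm A = ‖A‖ := by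
  refine le_antisymm (singVal_le_norm A one_pos) ?_
  rw [Matrix.l2_opNorm_def]
  refine ContinuousLinearMap.opNorm_le_bound _ (singVal_nonneg A 1) fun x => ?_
  obtain ⟨x⟩ := x
  change ‖WithLp.toLp 2 (A.mulVec x)‖ ≤ _ * ‖WithLp.toLp 2 x‖
  rw [← vecNorm_eq_norm_toLp, ← vecNorm_eq_norm_toLp]
  rcases eq_or_ne x 0 with rfl | hx
  · simp [vecNorm]
  have hpos := vecNorm_pos hx
  rw [← div_le_iff₀ hpos]
  refine le_csSup ⟨_, norm_mem_upperBounds_singVal A one_pos⟩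
    ⟨div_nonneg (Real.sqrt_nonneg _) hpos.le, Submodule.span ℝ {x}, finrank_span_singleton hx, ?_⟩
  intro y hy
  obtain ⟨a, rfl⟩ := Submodule.mem_span_singleton.mp hy
  rw [Matrix.mulVec_smul, vecNorm_smul, vecNorm_smul]
  apply le_of_eq
  field_simp

lemma specNorm_eq_zero_of_subsingleton {m n : ℕ} [Subsingleton (Matrix (Fin m) (Fin n) ℝ)]
    (A : Matrix (Fin m) (Fin n) ℝ) : specNorm A = 0 := by
  rw [specNorm_eq_norm, Subsingleton.elim A 0, norm_zero]

lemma inv_sq_specNorm_div_singVal_le_one {m n : ℕ} (A : Matrix (Fin m) (Fin n) ℝ) {k : ℕ}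
    (hk : 0 < k) : ((specNorm A / singVal A k) ^ 2)⁻¹ ≤ 1 := by
  rw [← inv_pow, inv_div]
  have h0 := singVal_nonneg A k
  have h1 : singVal A k ≤ specNorm A := (singVal_le_norm A hk).trans_eq (specNorm_eq_norm A).symm
  exact pow_le_one₀ (div_nonneg h0 (h0.trans h1)) (div_le_one_of_le₀ h1 (h0.trans h1))

lemma l2_opNorm_transpose {m n : ℕ} (A : Matrix (Fin m) (Fin n) ℝ) : ‖Aᵀ‖ = ‖A‖ := by
  rw [← Matrix.conjTranspose_eq_transpose_of_trivial, Matrix.l2_opNorm_conjTranspose]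

lemma l2_opNorm_le_one_of_transpose_mul_self {m n : ℕ} {A : Matrix (Fin m) (Fin n) ℝ}
    (hA : Aᵀ * A = 1) : ‖A‖ ≤ 1 := by
  have h1 := Matrix.l2_opNorm_conjTranspose_mul_self (1 : Matrix (Fin n) (Fin n) ℝ)
  have h2 := Matrix.l2_opNorm_conjTranspose_mul_self A
  rw [Matrix.conjTranspose_one, one_mul] at h1
  rw [Matrix.conjTranspose_eq_transpose_of_trivial, hA] at h2
  have h3 : ‖(1 : Matrix (Fin n) (Fin n) ℝ)‖ ≤ 1 := by
    by_contra! h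
    nlinarith
  by_contra! h
  nlinarith

lemma l2_opNorm_mul_le_of_le_one_left {l m n : ℕ} {A : Matrix (Fin l) (Fin m) ℝ}
    (hA : ‖A‖ ≤ 1) (B : Matrix (Fin m) (Fin n) ℝ) : ‖A * B‖ ≤ ‖B‖ :=
  (Matrix.l2_opNorm_mul A B).trans (mul_le_of_le_one_left (norm_nonneg B) hA)

lemma l2_opNorm_mul_le_of_le_one_right {l m n : ℕ} (A : Matrix (Fin l) (Fin m) ℝ)
    {B : Matrix (Fin m) (Fin n) ℝ} (hB : ‖B‖ ≤ 1) : ‖A * B‖ ≤ ‖A‖ :=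
  (Matrix.l2_opNorm_mul A B).trans (mul_le_of_le_one_right (norm_nonneg A) hB)

/-- If the column space of a symmetric `Y` makes a small principal angle with that of `V`, which
contains the column space of a symmetric `X`, then `X - Y` is controlled by its compression
`Vᵀ * (X - Y)`. -/
lemma l2_opNorm_sub_le_three_mul {n p q s : ℕ} {X Y : Matrix (Fin n) (Fin n) ℝ}
    {V : Matrix (Fin n) (Fin p) ℝ} {Vp : Matrix (Fin n) (Fin q) ℝ} {L : Matrix (Fin n) (Fin s) ℝ}
    (hX : Xᵀ = X) (hY : Yᵀ = Y) (hV : Vᵀ * V = 1) (hVp : Vpᵀ * Vp = 1)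
    (hsum : V * Vᵀ + Vp * Vpᵀ = 1) (hVX : V * Vᵀ * X = X)
    (hL : Lᵀ * L = 1) (hLY : L * Lᵀ * Y = Y) (hangle : ‖Vpᵀ * L‖ ≤ 1 / 2) :
    ‖X - Y‖ ≤ 3 * ‖Vᵀ * (X - Y)‖ := by
  have nV := l2_opNorm_le_one_of_transpose_mul_self hV
  have nVp := l2_opNorm_le_one_of_transpose_mul_self hVp
  have nL := l2_opNorm_le_one_of_transpose_mul_self hL
  have nVt : ‖Vᵀ‖ ≤ 1 := (l2_opNorm_transpose V).trans_le nV
  have nVpt : ‖Vpᵀ‖ ≤ 1 := (l2_opNorm_transpose Vp).trans_le nVp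
  have nLt : ‖Lᵀ‖ ≤ 1 := (l2_opNorm_transpose L).trans_le nL
  have hVVp : V * Vᵀ * Vp = 0 := by
    have h := congrArg (· * Vp) hsum
    simpa only [Matrix.add_mul, Matrix.mul_assoc, hVp, Matrix.mul_one, Matrix.one_mul,
      add_eq_right] using h
  have hXV : X * (V * Vᵀ) = X := by
    have h := congrArg Matrix.transpose hVX
    simpa [Matrix.transpose_mul, hX] using h
  have hXVp : X * Vp = 0 := by
    rw [← hXV, Matrix.mul_assoc, hVVp, Matrix.mul_zero]
  have hAVp : (X - Y) * Vp = -(Y * Vp) := by rw [Matrix.sub_mul, hXVp, zero_sub]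
  have hN_le : ‖Y * Vp‖ ≤ ‖Lᵀ * (Y * Vp)‖ := by
    have h : Y * Vp = L * (Lᵀ * (Y * Vp)) := by
      rw [← Matrix.mul_assoc, ← Matrix.mul_assoc, hLY]
    calc ‖Y * Vp‖ = ‖L * (Lᵀ * (Y * Vp))‖ := by rw [← h]
      _ ≤ _ := l2_opNorm_mul_le_of_le_one_left nL _
  have hsplit : Lᵀ * (Y * Vp) =
      Lᵀ * V * (Vᵀ * (Y * Vp)) + (Vpᵀ * L)ᵀ * (Vpᵀ * (Y * Vp)) := by
    calc Lᵀ * (Y * Vp) = Lᵀ * ((V * Vᵀ + Vp * Vpᵀ) * (Y * Vp)) := by rw [hsum, Matrix.one_mul]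
      _ = _ := by
        simp [Matrix.add_mul, Matrix.mul_add, Matrix.mul_assoc, Matrix.transpose_mul]
  have hVN : ‖Vᵀ * (Y * Vp)‖ ≤ ‖Vᵀ * (X - Y)‖ := by
    have h : Vᵀ * (Y * Vp) = -(Vᵀ * (X - Y) * Vp) := by
      rw [Matrix.mul_assoc, hAVp, Matrix.mul_neg, neg_neg]
    rw [h, norm_neg]
    exact l2_opNorm_mul_le_of_le_one_right _ nVp
  have h1 : ‖Lᵀ * V * (Vᵀ * (Y * Vp))‖ ≤ ‖Vᵀ * (X - Y)‖ :=
    (l2_opNorm_mul_le_of_le_one_left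
      ((l2_opNorm_mul_le_of_le_one_left nLt V).trans nV) _).trans hVN
  have h2 : ‖(Vpᵀ * L)ᵀ * (Vpᵀ * (Y * Vp))‖ ≤ 1 / 2 * ‖Y * Vp‖ := by
    refine (Matrix.l2_opNorm_mul _ _).trans ?_
    rw [l2_opNorm_transpose]
    gcongr
    exact l2_opNorm_mul_le_of_le_one_left nVpt _
  have h3 : ‖Lᵀ * (Y * Vp)‖ ≤ ‖Vᵀ * (X - Y)‖ + 1 / 2 * ‖Y * Vp‖ := by
    rw [hsplit]
    exact (norm_add_le _ _).trans (add_le_add h1 h2)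
  have hAV : ‖(X - Y) * V * Vᵀ‖ ≤ ‖Vᵀ * (X - Y)‖ := by
    refine (l2_opNorm_mul_le_of_le_one_right _ nVt).trans_eq ?_
    rw [← l2_opNorm_transpose, Matrix.transpose_mul, Matrix.transpose_sub, hX, hY]
  have hAVp_le : ‖(X - Y) * Vp * Vpᵀ‖ ≤ ‖Y * Vp‖ := by
    refine (l2_opNorm_mul_le_of_le_one_right _ nVpt).trans_eq ?_
    rw [hAVp, norm_neg]
  have hA : X - Y = (X - Y) * V * Vᵀ + (X - Y) * Vp * Vpᵀ := by
    rw [Matrix.mul_assoc, Matrix.mul_assoc, ← Matrix.mul_add, hsum, Matrix.mul_one]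
  have h4 : ‖X - Y‖ ≤ ‖(X - Y) * V * Vᵀ‖ + ‖(X - Y) * Vp * Vpᵀ‖ :=
    (congrArg norm hA).trans_le (norm_add_le _ _)
  linarith

end L2Operator

/-- `‖X♮ − U_tW_tW_tᵀU_tᵀ‖ ≤ 4‖V_{X♮}ᵀ(X♮ − U_tU_tᵀ)‖`. -/
theorem lemma_error_bound_three :
    ∃ c : ℝ, 0 < c ∧
      ∀ (n r rstar : ℕ)
        (Unat : Matrix (Fin n) (Fin rstar) ℝ) (Xnat : Matrix (Fin n) (Fin n) ℝ),
        Xnat = Unat * Unatᵀ → Xnat.rank = rstar →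
        ∀ (kappaf : ℝ), kappaf = specNorm Unat / singVal Unat rstar →
        ∀ (Ut : Matrix (Fin n) (Fin r) ℝ)
          (VX : Matrix (Fin n) (Fin rstar) ℝ)
          (VXperp : Matrix (Fin n) (Fin (n - rstar)) ℝ)
          (W : Matrix (Fin r) (Fin rstar) ℝ)
          (Wperp : Matrix (Fin r) (Fin (r - rstar)) ℝ)
          (VUW : Matrix (Fin n) (Fin rstar) ℝ),
        -- V_{X♮} is an orthonormal basis of the column space of X♮,
        -- V_{X♮⊥} of its orthogonal complement
        VXᵀ * VX = 1 → VX * VXᵀ * Xnat = Xnat →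
        VXperpᵀ * VXperp = 1 → VX * VXᵀ + VXperp * VXperpᵀ = 1 →
        -- W_t comes from the SVD of V_{X♮}ᵀ U_t, and W_{t,⊥} is an orthonormal
        -- complement of W_t
        Wᵀ * W = 1 → VXᵀ * Ut * (W * Wᵀ) = VXᵀ * Ut →
        Wperpᵀ * Wperp = 1 → Wᵀ * Wperp = 0 → W * Wᵀ + Wperp * Wperpᵀ = 1 →
        -- V_{U_tW_t} is an orthonormal basis of the column space of U_tW_t
        VUWᵀ * VUW = 1 → VUW * VUWᵀ * (Ut * W) = Ut * W →
        -- assumptions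
        specNorm Ut ≤ 3 * specNorm Unat →
        singVal Unat rstar / Real.sqrt 10 ≤ singVal (Ut * W) rstar →
        specNorm (VXperpᵀ * VUW) ≤ c * (kappaf ^ 2)⁻¹ →
        specNorm (Xnat - Ut * W * Wᵀ * Utᵀ) ≤
          4 * specNorm (VXᵀ * (Xnat - Ut * Utᵀ)) := by
  refine ⟨1 / 2, by norm_num, ?_⟩
  rintro n r rstar Unat Xnat hXnat - kappaf hkappa Ut VX VXperp W Wperp VUW hVX hVXX hVXperp hsum
    - hWW - - - hVUW hVUWU - - hangle
  have hX : Xnatᵀ = Xnat := by simp [hXnat, Matrix.transpose_mul]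
  have hY : (Ut * W * Wᵀ * Utᵀ)ᵀ = Ut * W * Wᵀ * Utᵀ := by
    simp [Matrix.transpose_mul, Matrix.mul_assoc]
  have hLY : VUW * VUWᵀ * (Ut * W * Wᵀ * Utᵀ) = Ut * W * Wᵀ * Utᵀ := by
    rw [← Matrix.mul_assoc, ← Matrix.mul_assoc, hVUWU]
  have hVY : VXᵀ * (Xnat - Ut * Utᵀ) = VXᵀ * (Xnat - Ut * W * Wᵀ * Utᵀ) := by
    rw [Matrix.mul_sub, Matrix.mul_sub, ← Matrix.mul_assoc VXᵀ Ut, ← hWW]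
    simp only [Matrix.mul_assoc]
  have hhalf : specNorm (VXperpᵀ * VUW) ≤ 1 / 2 := by
    rcases Nat.eq_zero_or_pos rstar with rfl | hpos
    · rw [specNorm_eq_zero_of_subsingleton]
      norm_num
    · have := inv_sq_specNorm_div_singVal_le_one Unat hpos
      rw [← hkappa] at this
      linarith
  rw [specNorm_eq_norm] at hhalf
  have h := l2_opNorm_sub_le_three_mul hX hY hVX hVXperp hsum hVXX hVUW hLY hhalf
  rw [← specNorm_eq_norm, ← specNorm_eq_norm] at h
  rw [hVY]
  exact h.trans (mul_le_mul_of_nonneg_right (by norm_num) (singVal_nonneg _ 1))
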